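/- With the needle-in-haystack construction below, there exists a constant C > 0, depending only on d, ζ and h (and not on ε, w, j or M), such that for every region index j ∈ {1,…,M}: Σ_{m=1}^M v̄_m^j ≤ C·ε. -/

import Mathlib

open MeasureTheory Real

noncomputable section

/-- The `d`-dimensional bump function `H(ξ) = exp(−1/(1−‖ξ‖₂²))` for `‖ξ‖₂ < 1`, `0` otherwise. -/
def bumpH (d : ℕ) (ξ : Fin d → ℝ) : ℝ :=
  if (∑ i, ξ i ^ 2) < 1 then Real.exp (-1 / (1 - ∑ i, ξ i ^ 2)) else 0

/-- The inverse Fourier transform of `bumpH`, as a complex number: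
`∫ H(ξ) e^{2πi⟨x,ξ⟩} dξ`. -/
def bumphC (d : ℕ) (x : Fin d → ℝ) : ℂ :=
  ∫ ξ : Fin d → ℝ, (bumpH d ξ : ℂ) * Complex.exp (2 * Real.pi * Complex.I * (∑ i, x i * ξ i))

/-- The inverse Fourier transform `h` of the bump function `H` (real-valued since `H` is real
and even). -/
def bumph (d : ℕ) (x : Fin d → ℝ) : ℝ :=
  (bumphC d x).re

/-- The cube of the uniform axis-aligned grid of step `w` indexed by `j ∈ {0,…,K−1}^d`. -/
def gridCube {d K : ℕ} (w : ℝ) (j : Fin d → Fin K) : Set (Fin d → ℝ) :=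
  Set.Icc (fun l => (j l : ℝ) * w) (fun l => ((j l : ℝ) + 1) * w)

/-- The center of the grid cube indexed by `j`. -/
def gridCenter {d K : ℕ} (w : ℝ) (j : Fin d → Fin K) : Fin d → ℝ :=
  fun l => ((j l : ℝ) + 1 / 2) * w

/-- The needle function `f_m(x) = g(x − c_m)` with `g(x) = (2ε/h(0)) h(xζ/w)`. -/
def needle (d : ℕ) (ζ ε w : ℝ) (c : Fin d → ℝ) (x : Fin d → ℝ) : ℝ :=
  (2 * ε / bumph d 0) * bumph d (fun l => (x l - c l) * ζ / w)

/-- `v̄_m^j = sup_{x ∈ R_j} f_m(x)` for the needle construction. -/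
def vbar {d K : ℕ} (ζ ε w : ℝ) (m j : Fin d → Fin K) : ℝ :=
  sSup (needle d ζ ε w (gridCenter w m) '' gridCube w j)

end

/-- The bump function `bumpH` expressed through Mathlib's smooth gluing function. -/
lemma bumpH_eq_expNegInvGlue (d : ℕ) (ξ : Fin d → ℝ) :
    bumpH d ξ = expNegInvGlue (1 - ∑ i, ξ i ^ 2) := by
  unfold bumpH expNegInvGlue
  by_cases h : (∑ i, ξ i ^ 2) < 1
  · rw [if_pos h, if_neg (by linarith), neg_div, one_div]
  · rw [if_neg h, if_pos (by linarith)]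

lemma contDiff_bumpH_ofLp (d : ℕ) (n : ℕ∞) :
    ContDiff ℝ n fun ξ : EuclideanSpace ℝ (Fin d) => (bumpH d ξ.ofLp : ℂ) := by
  simp_rw [bumpH_eq_expNegInvGlue, ← EuclideanSpace.real_norm_sq_eq]
  exact Complex.ofRealCLM.contDiff.comp
    (expNegInvGlue.contDiff.comp (contDiff_const.sub (contDiff_norm_sq ℝ)))

lemma hasCompactSupport_bumpH_ofLp (d : ℕ) :
    HasCompactSupport fun ξ : EuclideanSpace ℝ (Fin d) => (bumpH d ξ.ofLp : ℂ) := by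
  refine HasCompactSupport.intro (isCompact_closedBall 0 1) fun ξ hξ => ?_
  rw [mem_closedBall_zero_iff, not_le] at hξ
  rw [bumpH_eq_expNegInvGlue, ← EuclideanSpace.real_norm_sq_eq,
    expNegInvGlue.zero_of_nonpos (by nlinarith), Complex.ofReal_zero]

open scoped FourierTransform in
lemma bumphC_eq_fourierInv (d : ℕ) (x : Fin d → ℝ) :
    bumphC d x = 𝓕⁻ (fun ξ : EuclideanSpace ℝ (Fin d) => (bumpH d ξ.ofLp : ℂ))
      (WithLp.toLp 2 x) := by
  rw [Real.fourierInv_eq', bumphC, ← (PiLp.volume_preserving_ofLp (Fin d)).integral_comp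
    (MeasurableEquiv.toLp 2 (Fin d → ℝ)).symm.measurableEmbedding]
  refine integral_congr_ae (.of_forall fun ξ => ?_)
  simp only [PiLp.inner_apply, smul_eq_mul, mul_comm (bumpH d _ : ℂ)]
  congr 2
  push_cast
  simp
  ring

open scoped FourierTransform in
/-- Rapid decay of `bumph` in product form. -/
lemma exists_abs_bumph_le_prod (d : ℕ) :
    ∃ D : ℝ, 0 < D ∧ ∀ x : Fin d → ℝ, |bumph d x| ≤ D * ∏ l, (1 + x l ^ 2)⁻¹ := by
  let f := 𝓕⁻ ((hasCompactSupport_bumpH_ofLp d).toSchwartzMap (contDiff_bumpH_ofLp d ⊤))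
  obtain ⟨D, hD⟩ : ∃ D : ℝ, ∀ x, (1 + ‖x‖) ^ (2 * d) * ‖f x‖ ≤ D :=
    ⟨_, fun x => by
      simpa using SchwartzMap.one_add_le_sup_seminorm_apply (𝕜 := ℝ) (m := (2 * d, 0)) le_rfl
        le_rfl f x⟩
  have hD0 : 0 ≤ D := le_trans (by positivity) (hD 0)
  refine ⟨D + 1, by positivity, fun x => ?_⟩
  have hfx : bumphC d x = f (WithLp.toLp 2 x) := by
    rw [bumphC_eq_fourierInv, SchwartzMap.fourierInv_coe]
    rfl
  have hprod : ∏ l, (1 + x l ^ 2) ≤ (1 + ‖WithLp.toLp 2 x‖) ^ (2 * d) := by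
    calc ∏ l, (1 + x l ^ 2) ≤ ∏ _l : Fin d, (1 + ‖WithLp.toLp 2 x‖) ^ 2 := by
          refine Finset.prod_le_prod (fun _ _ => by positivity) fun l _ => ?_
          have h := PiLp.norm_apply_le (WithLp.toLp 2 x) l
          have h' := pow_le_pow_left₀ (norm_nonneg _) h 2
          simp only [Real.norm_eq_abs, sq_abs] at h'
          nlinarith [norm_nonneg (WithLp.toLp 2 x)]
      _ = _ := by simp [pow_mul]
  have hpos : 0 < ∏ l, (1 + x l ^ 2) := Finset.prod_pos fun _ _ => by positivity
  rw [Finset.prod_inv_distrib, ← div_eq_mul_inv, le_div_iff₀ hpos]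
  calc |bumph d x| * ∏ l, (1 + x l ^ 2)
      ≤ ‖f (WithLp.toLp 2 x)‖ * (1 + ‖WithLp.toLp 2 x‖) ^ (2 * d) := by
        rw [← hfx]
        gcongr
        exact Complex.abs_re_le_norm _
    _ ≤ D + 1 := by
        rw [mul_comm]
        exact (hD _).trans (le_add_of_nonneg_right zero_le_one)

lemma summable_inv_one_add_mul_sq {a : ℝ} (ha : 0 < a) :
    Summable fun n : ℤ => (1 + a * (n : ℝ) ^ 2)⁻¹ := by
  refine Summable.of_norm_bounded_eventually
    ((Real.summable_one_div_int_pow (p := 2)).2 one_lt_two |>.mul_left a⁻¹) ?_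
  filter_upwards [(Set.finite_singleton (0 : ℤ)).compl_mem_cofinite] with n hn
  have hn' : (n : ℝ) ≠ 0 := by exact_mod_cast hn
  rw [Real.norm_of_nonneg (by positivity), one_div, ← mul_inv]
  exact inv_anti₀ (by positivity) (by linarith)

/-- On a grid cube, the distance to the center of another cube is at least half the index
distance, in every coordinate and in units of `w`. -/
lemma sq_index_sub_le_of_mem_gridCube {d K : ℕ} {w ζ : ℝ} (hw : 0 < w) (m j : Fin d → Fin K)
    {x : Fin d → ℝ} (hx : x ∈ gridCube w j) (l : Fin d) :
    ζ ^ 2 / 4 * (((j l : ℤ) - (m l : ℤ) : ℤ) : ℝ) ^ 2 ≤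
      ((x l - gridCenter w m l) * ζ / w) ^ 2 := by
  have h1 := hx.1 l
  have h2 := hx.2 l
  simp only at h1 h2
  obtain ⟨t, ht⟩ : ∃ t, x l = t * w := ⟨x l / w, by field_simp⟩
  rw [ht] at h1 h2
  have ht1 := le_of_mul_le_mul_right h1 hw
  have ht2 := le_of_mul_le_mul_right h2 hw
  have hcoord : (x l - gridCenter w m l) * ζ / w = ζ * (t - (m l : ℝ) - 1 / 2) := by
    rw [ht, gridCenter]
    field_simp
    ring
  rw [hcoord, mul_pow, div_mul_eq_mul_div, mul_div_assoc]
  refine mul_le_mul_of_nonneg_left ?_ (sq_nonneg ζ)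
  set n : ℤ := (j l : ℤ) - (m l : ℤ) with hn
  have hnr : (n : ℝ) = (j l : ℝ) - (m l : ℝ) := by rw [hn]; push_cast; rfl
  have hs1 : (n : ℝ) - 1 / 2 ≤ t - (m l : ℝ) - 1 / 2 := by linarith
  have hs2 : t - (m l : ℝ) - 1 / 2 ≤ n + 1 / 2 := by linarith
  rcases lt_trichotomy n 0 with h | h | h
  · have : (n : ℝ) ≤ -1 := by exact_mod_cast Int.le_sub_one_of_lt h
    nlinarith
  · simp only [h, Int.cast_zero]
    nlinarith [sq_nonneg (t - (m l : ℝ) - 1 / 2)]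
  · have : (1 : ℝ) ≤ n := by exact_mod_cast h
    nlinarith

lemma vbar_le_prod {d K : ℕ} {ζ ε w D : ℝ} (hε : 0 < ε) (hw : 0 < w) (hD : 0 < D)
    (h0 : 0 < bumph d 0)
    (hdecay : ∀ x : Fin d → ℝ, |bumph d x| ≤ D * ∏ l, (1 + x l ^ 2)⁻¹) (m j : Fin d → Fin K) :
    vbar ζ ε w m j ≤ 2 * ε / bumph d 0 *
      (D * ∏ l, (1 + ζ ^ 2 / 4 * (((j l : ℤ) - (m l : ℤ) : ℤ) : ℝ) ^ 2)⁻¹) := by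
  refine Real.sSup_le ?_ ?_
  · rintro _ ⟨x, hx, rfl⟩
    refine mul_le_mul_of_nonneg_left ?_ (by positivity)
    refine (le_abs_self _).trans ((hdecay _).trans ?_)
    refine mul_le_mul_of_nonneg_left ?_ hD.le
    refine Finset.prod_le_prod (fun _ _ => by positivity) fun l _ => ?_
    exact inv_anti₀ (by positivity)
      (by linarith [sq_index_sub_le_of_mem_gridCube (ζ := ζ) hw m j hx l])
  · exact mul_nonneg (by positivity)
      (mul_nonneg hD.le (Finset.prod_nonneg fun _ _ => by positivity))

lemma sum_prod_index_sub_le {d K : ℕ} {a : ℤ → ℝ} (ha : ∀ n, 0 ≤ a n) (hs : Summable a)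
    (j : Fin d → Fin K) :
    ∑ m : Fin d → Fin K, ∏ l, a ((j l : ℤ) - (m l : ℤ)) ≤ (∑' n, a n) ^ d := by
  have hswap : ∑ m : Fin d → Fin K, ∏ l, a ((j l : ℤ) - (m l : ℤ)) =
      ∏ l, ∑ k : Fin K, a ((j l : ℤ) - (k : ℤ)) := by
    rw [Finset.prod_univ_sum, Fintype.piFinset_univ]
  rw [hswap]
  calc ∏ l, ∑ k : Fin K, a ((j l : ℤ) - (k : ℤ)) ≤ ∏ _l : Fin d, ∑' n, a n := by
        refine Finset.prod_le_prod (fun _ _ => Finset.sum_nonneg fun _ _ => ha _) fun l _ => ?_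
        have hinj : Function.Injective fun k : Fin K => (j l : ℤ) - (k : ℤ) := fun p q h => by
          simp only at h
          omega
        rw [← tsum_fintype (L := .unconditional _)]
        exact (hs.comp_injective hinj).tsum_le_tsum_of_inj _ hinj (fun _ _ => ha _)
          (fun _ => le_rfl) hs
    _ = _ := by simp

/-- Lemma 5, part 2: in the needle-in-haystack construction,
`Σ_{m=1}^M v̄_m^j ≤ C·ε` for a constant `C` depending only on `d`, `ζ` and `h`. -/
theorem sum_over_needles_vbar_le (d : ℕ) (hd : 1 ≤ d) (ζ : ℝ) (hζ : 0 < ζ)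
    (hζprop : ∀ x : Fin d → ℝ, (∃ i, ζ < |x i|) → |bumph d x| < bumph d 0 / 2) :
    ∃ C > (0 : ℝ), ∀ ε w : ℝ, 0 < ε → 0 < w → w < 1 →
      ∀ j : Fin d → Fin (Nat.floor (1 / w)),
        ∑ m : Fin d → Fin (Nat.floor (1 / w)), vbar ζ ε w m j ≤ C * ε := by
  have h0 : 0 < bumph d 0 := by
    have h := hζprop (fun _ => ζ + 1) ⟨⟨0, hd⟩, lt_of_lt_of_le (lt_add_one ζ) (le_abs_self _)⟩
    linarith [abs_nonneg (bumph d fun _ => ζ + 1)]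
  obtain ⟨D, hD, hdecay⟩ := exists_abs_bumph_le_prod d
  let a : ℤ → ℝ := fun n => (1 + ζ ^ 2 / 4 * (n : ℝ) ^ 2)⁻¹
  have ha : ∀ n, 0 < a n := fun n => by positivity
  have hs : Summable a := summable_inv_one_add_mul_sq (by positivity)
  have hS : 0 < ∑' n, a n := hs.tsum_pos (fun n => (ha n).le) 0 (ha 0)
  refine ⟨2 / bumph d 0 * D * (∑' n, a n) ^ d, by positivity, fun ε w hε hw _ j => ?_⟩
  calc ∑ m, vbar ζ ε w m j
      ≤ ∑ m : Fin d → Fin (Nat.floor (1 / w)),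
          2 * ε / bumph d 0 * (D * ∏ l, a ((j l : ℤ) - (m l : ℤ))) :=
        Finset.sum_le_sum fun m _ => vbar_le_prod hε hw hD h0 hdecay m j
    _ = 2 * ε / bumph d 0 * (D * ∑ m : Fin d → Fin (Nat.floor (1 / w)),
          ∏ l, a ((j l : ℤ) - (m l : ℤ))) := by
        rw [Finset.mul_sum, Finset.mul_sum]
    _ ≤ 2 * ε / bumph d 0 * (D * (∑' n, a n) ^ d) := by
        gcongr
        exact sum_prod_index_sub_le (fun n => (ha n).le) hs j
    _ = _ := by ring
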